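/- arXiv:1208.6501 — 2 statements merged into one kernel-verified Lean document; each statement's English description precedes it below -/
import Mathlib

section
/- If an allocation rule X is the allocation rule of a feasible FNPW PORF mechanism (X is FNPW-implementable), then X satisfies withdrawal-monotonicity: for all valuations θ_i, θ_i^L, θ_i^U, θ^a and every multiset θ_{-i} of valuations, if v(θ_i^L, X(θ_i^L, θ_{-i})) = 0 and X(θ_i^U, θ_{-i} ∪ {θ^a}) = X(θ_i, θ_{-i}), then v(θ_i^L, X(θ_i, θ_{-i})) ≤ v(θ_i^U, X(θ_i, θ_{-i})). -/
attribute [local instance] Classical.propDecidable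

/-- A valuation over the item set `G`: normalized at `∅`, nonnegative,
and monotone under inclusion (free disposal). -/
structure Valn (G : Type*) where
  v : Finset G → ℝ
  v_empty : v ∅ = 0
  v_nonneg : ∀ S, 0 ≤ v S
  v_mono : ∀ ⦃S T : Finset G⦄, S ⊆ T → v S ≤ v T

variable {G : Type*} [Fintype G] [DecidableEq G]

/-- A price function: nonnegative, zero on the empty bundle, monotone in the bundle. -/
def IsPrice (χ : Finset G → Multiset (Valn G) → ℝ) : Prop :=
  (∀ S O, 0 ≤ χ S O) ∧ (∀ O, χ (∅ : Finset G) O = 0) ∧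
    (∀ ⦃S T : Finset G⦄, S ⊆ T → ∀ O, χ S O ≤ χ T O)

/-- `X` is the allocation rule of the PORF mechanism with price function `χ`:
each agent receives a bundle maximizing her value minus price, given the
multiset of the other agents' reported valuations. -/
def IsPORF (χ : Finset G → Multiset (Valn G) → ℝ)
    (X : Valn G → Multiset (Valn G) → Finset G) : Prop :=
  ∀ (θ : Valn G) (O : Multiset (Valn G)) (S : Finset G),
    θ.v S - χ S O ≤ θ.v (X θ O) - χ (X θ O) O

/-- The multiset of reports faced by the `j`-th kept false-name identity:
the true other agents `θmi`, the remaining kept identities, and the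
withdrawn identities `W`. -/
def othersOf {k : ℕ} (kept : Fin k → Valn G) (j : Fin k)
    (θmi W : Multiset (Valn G)) : Multiset (Valn G) :=
  θmi + (Finset.univ.erase j).val.map kept + W

/-- False-name-proofness with withdrawal: reporting truthfully with a single
identity is always at least as good as submitting kept false-name reports
`kept 0, …, kept (k-1)` together with withdrawn false-name reports `W`. -/
def FNPW (χ : Finset G → Multiset (Valn G) → ℝ)
    (X : Valn G → Multiset (Valn G) → Finset G) : Prop :=
  ∀ (θi : Valn G) (θmi : Multiset (Valn G)) (k : ℕ)
    (kept : Fin k → Valn G) (W : Multiset (Valn G)),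
    θi.v (Finset.univ.sup fun j : Fin k => X (kept j) (othersOf kept j θmi W))
        - ∑ j : Fin k, χ (X (kept j) (othersOf kept j θmi W)) (othersOf kept j θmi W)
      ≤ θi.v (X θi θmi) - χ (X θi θmi) θmi

/-- No superadditive price increase with withdrawal: running the mechanism on a
multiset `O` of agents, for disjoint sub-multisets `Y`, `Z` of `O`, the total
price paid by the agents in `Y` is at least the price of the union of their
bundles when facing `O - Y - Z`. -/
def NSAW (χ : Finset G → Multiset (Valn G) → ℝ)
    (X : Valn G → Multiset (Valn G) → Finset G) : Prop :=
  ∀ (O Y Z : Multiset (Valn G)), Y + Z ≤ O →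
    χ ((Y.map fun i => X i (O.erase i)).sup) (O - Y - Z)
      ≤ (Y.map fun i => χ (X i (O.erase i)) (O.erase i)).sum

/-- Feasibility: running the mechanism on any finite family of agents, no item
is ever allocated to two different agents. -/
def Feasible (X : Valn G → Multiset (Valn G) → Finset G) : Prop :=
  ∀ (k : ℕ) (ag : Fin k → Valn G) (i j : Fin k), i ≠ j →
    Disjoint (X (ag i) ((Finset.univ.erase i).val.map ag))
             (X (ag j) ((Finset.univ.erase j).val.map ag))

/-- Withdrawal-monotonicity of an allocation rule. -/
def WithdrawalMono (X : Valn G → Multiset (Valn G) → Finset G) : Prop :=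
  ∀ (θi θiL θiU θa : Valn G) (θmi : Multiset (Valn G)),
    θiL.v (X θiL θmi) = 0 →
    X θiU (θa ::ₘ θmi) = X θi θmi →
    θiL.v (X θi θmi) ≤ θiU.v (X θi θmi)

/-- The single-minded valuation worth `M` exactly on the bundles containing the
nonempty bundle `S`. -/
noncomputable def Valn.singleMinded {G : Type*} (S : Finset G) (hS : S.Nonempty) (M : ℝ)
    (hM : 0 ≤ M) : Valn G where
  v T := if S ⊆ T then M else 0
  v_empty := by simp [hS.ne_empty]
  v_nonneg T := by split_ifs <;> simp [hM]
  v_mono A B hAB := by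
    by_cases hA : S ⊆ A
    · simp [hA, hA.trans hAB]
    · simp only [hA, if_false]
      split_ifs <;> simp [hM]

theorem Valn.singleMinded_of_subset {G : Type*} {S T : Finset G} (hS : S.Nonempty) {M : ℝ}
    (hM : 0 ≤ M) (hST : S ⊆ T) : (Valn.singleMinded S hS M hM).v T = M :=
  if_pos hST

theorem Valn.singleMinded_of_not_subset {G : Type*} {S T : Finset G} (hS : S.Nonempty) {M : ℝ}
    (hM : 0 ≤ M) (hST : ¬S ⊆ T) : (Valn.singleMinded S hS M hM).v T = 0 :=
  if_neg hST

/-- One kept identity facing one withdrawn identity. -/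
theorem FNPW.single_kept {G : Type*} [DecidableEq G]
    {χ : Finset G → Multiset (Valn G) → ℝ}
    {X : Valn G → Multiset (Valn G) → Finset G} (hFNPW : FNPW χ X)
    (θ θU θa : Valn G) (O : Multiset (Valn G)) :
    θ.v (X θU (θa ::ₘ O)) - χ (X θU (θa ::ₘ O)) (θa ::ₘ O) ≤ θ.v (X θ O) - χ (X θ O) O := by
  have hothers : othersOf (fun _ : Fin 1 => θU) 0 O {θa} = θa ::ₘ O := by
    simp [othersOf, add_comm O, Multiset.singleton_add]
  simpa [hothers] using hFNPW θ O 1 (fun _ => θU) {θa}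

/-- A bundle won in the presence of an extra agent costs at least as much as the
same bundle after that agent has withdrawn. -/
theorem FNPW.price_le_of_withdraw {G : Type*} [DecidableEq G]
    {χ : Finset G → Multiset (Valn G) → ℝ}
    {X : Valn G → Multiset (Valn G) → Finset G} (hχ : IsPrice χ) (hFNPW : FNPW χ X)
    (θU θa : Valn G) (O : Multiset (Valn G)) :
    χ (X θU (θa ::ₘ O)) O ≤ χ (X θU (θa ::ₘ O)) (θa ::ₘ O) := by
  obtain ⟨hnonneg, hempty, hmono⟩ := hχ
  rcases (X θU (θa ::ₘ O)).eq_empty_or_nonempty with hS | hS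
  · rw [hS, hempty, hempty]
  · have hM : 0 ≤ χ (X θU (θa ::ₘ O)) (θa ::ₘ O) + 1 :=
      add_nonneg (hnonneg _ _) zero_le_one
    have h := hFNPW.single_kept (Valn.singleMinded _ hS _ hM) θU θa O
    rw [Valn.singleMinded_of_subset hS hM (Finset.Subset.refl _)] at h
    by_cases hsub : X θU (θa ::ₘ O) ⊆ X (Valn.singleMinded _ hS _ hM) O
    · rw [Valn.singleMinded_of_subset hS hM hsub] at h
      linarith [hmono hsub O]
    · rw [Valn.singleMinded_of_not_subset hS hM hsub] at h
      linarith [hnonneg (X (Valn.singleMinded _ hS _ hM) O) O]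

/-- If `X` is the allocation rule of a feasible FNPW PORF mechanism
(`X` is FNPW-implementable), then `X` satisfies withdrawal-monotonicity. -/
theorem fnpw_implies_withdrawalMono (χ : Finset G → Multiset (Valn G) → ℝ)
    (X : Valn G → Multiset (Valn G) → Finset G)
    (hχ : IsPrice χ) (hX : IsPORF χ X) (hfeas : Feasible X)
    (hFNPW : FNPW χ X) :
    WithdrawalMono X := by
  intro θi θL θU θa O hL hU
  have hLS := hX θL O (X θi O)
  have hUS := hX θU (θa ::ₘ O) ∅
  have hprice := hFNPW.price_le_of_withdraw hχ θU θa O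
  rw [hU] at hUS hprice
  rw [θU.v_empty, hχ.2.1] at hUS
  linarith [hχ.1 (X θL O) O]
end

section
/- Suppose the type space Θ contains all additive valuations (all valuations of the form v(S) = Σ_{s∈S} c_s with c_s ≥ 0). If the VCG mechanism on Θ is false-name-proof with withdrawal (FNPW), then Θ satisfies the submodularity condition: for every finite multiset Y of valuations from Θ and all S₁, S₂ ⊆ G, U(S₁,Y) + U(S₂,Y) ≥ U(S₁∪S₂,Y) + U(S₁∩S₂,Y). -/
attribute [local instance] Classical.propDecidable

variable {G : Type*} [Fintype G] [DecidableEq G]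

/-- `U S L` is the maximal total value obtainable by allocating pairwise
disjoint sub-bundles of `S` to the agents in the list `L`. -/
noncomputable def U : Finset G → List (Valn G) → ℝ
  | _, [] => 0
  | S, w :: L => S.powerset.sup' (Finset.powerset_nonempty S) fun B => w.v B + U (S \ B) L

/-- The type space `Θ` satisfies the submodularity condition. -/
def SubmodularDomain (Θ : Set (Valn G)) : Prop :=
  ∀ (L : List (Valn G)), (∀ w ∈ L, w ∈ Θ) →
    ∀ S₁ S₂ : Finset G, U (S₁ ∪ S₂) L + U (S₁ ∩ S₂) L ≤ U S₁ L + U S₂ L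

/-- The VCG mechanism on the type space `Θ` is false-name-proof with
withdrawal: for any true type `θi ∈ Θ`, any others `θmi`, any kept false-name
reports `K` and withdrawn false-name reports `W` (all from `Θ`), and any
efficient allocation `A` for the manipulated profile `K ++ W ++ θmi`, the
utility the agent derives from the bundles of her kept identities at their VCG
prices never exceeds her truthful VCG utility `U(G, θi::θmi) − U(G, θmi)`. -/
def VCGFNPW (Θ : Set (Valn G)) : Prop :=
  ∀ θi : Valn G, θi ∈ Θ →
    ∀ θmi K W : List (Valn G),
      (∀ w ∈ θmi, w ∈ Θ) → (∀ w ∈ K, w ∈ Θ) → (∀ w ∈ W, w ∈ Θ) →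
      ∀ A : Fin (K ++ W ++ θmi).length → Finset G,
        (∀ i j, i ≠ j → Disjoint (A i) (A j)) →
        (∑ j, ((K ++ W ++ θmi).get j).v (A j) = U (Finset.univ : Finset G) (K ++ W ++ θmi)) →
        θi.v (Finset.univ.sup fun j : Fin K.length =>
            A (Fin.castLE (by simp only [List.length_append]; omega) j))
          - ∑ j : Fin K.length,
              (U (Finset.univ : Finset G) ((K ++ W ++ θmi).eraseIdx (j : ℕ))
                - U ((Finset.univ : Finset G) \
                      A (Fin.castLE (by simp only [List.length_append]; omega) j))
                    ((K ++ W ++ θmi).eraseIdx (j : ℕ)))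
        ≤ U (Finset.univ : Finset G) (θi :: θmi) - U (Finset.univ : Finset G) θmi

/-- The additive valuation worth `M` for each item of `T` and nothing for the other items. -/
noncomputable def Valn.const (M : ℝ) (hM : 0 ≤ M) (T : Finset G) : Valn G where
  v S := M * ((S ∩ T).card : ℝ)
  v_empty := by simp
  v_nonneg S := by positivity
  v_mono S S' h := by gcongr

theorem Valn.const_eq_sum (M : ℝ) (hM : 0 ≤ M) (T S : Finset G) :
    (Valn.const M hM T).v S = ∑ s ∈ S, if s ∈ T then M else 0 := by
  simp [Valn.const, mul_comm]

theorem U_nil (S : Finset G) : U S [] = 0 := by simp [U]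

theorem le_U_cons (w : Valn G) (L : List (Valn G)) {S B : Finset G} (h : B ⊆ S) :
    w.v B + U (S \ B) L ≤ U S (w :: L) := by
  rw [U]
  exact Finset.le_sup' (fun B => w.v B + U (S \ B) L) (Finset.mem_powerset.2 h)

theorem exists_U_cons (w : Valn G) (L : List (Valn G)) (S : Finset G) :
    ∃ B ⊆ S, w.v B + U (S \ B) L = U S (w :: L) := by
  obtain ⟨B, hB, h⟩ := Finset.exists_mem_eq_sup' (Finset.powerset_nonempty S)
    (fun B => w.v B + U (S \ B) L)
  exact ⟨B, Finset.mem_powerset.1 hB, by rw [U]; exact h.symm⟩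

theorem U_mono (L : List (Valn G)) {S T : Finset G} (h : S ⊆ T) : U S L ≤ U T L := by
  induction L generalizing S T with
  | nil => simp [U_nil]
  | cons w L ih =>
    obtain ⟨B, hB, hU⟩ := exists_U_cons w L S
    rw [← hU]
    exact (add_le_add_right (ih (Finset.sdiff_subset_sdiff h subset_rfl)) _).trans
      (le_U_cons w L (hB.trans h))

theorem U_nonneg (L : List (Valn G)) (S : Finset G) : 0 ≤ U S L := by
  induction L generalizing S with
  | nil => simp [U_nil]
  | cons w L ih =>
    exact (add_nonneg (w.v_nonneg ∅) (ih _)).trans (le_U_cons w L (Finset.empty_subset S))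

/-- An agent who values each item of `T` above everything the others can obtain wins `T`. -/
theorem U_const_cons (L : List (Valn G)) {M : ℝ} (hM : 0 ≤ M) (hML : U Finset.univ L ≤ M)
    {S T : Finset G} (hT : T ⊆ S) :
    U S (Valn.const M hM T :: L) = M * (T.card : ℝ) + U (S \ T) L := by
  apply le_antisymm
  · obtain ⟨B, -, hU⟩ := exists_U_cons (Valn.const M hM T) L S
    rw [← hU]
    change M * ((B ∩ T).card : ℝ) + _ ≤ _
    by_cases hTB : T ⊆ B
    · rw [Finset.inter_eq_right.2 hTB]
      exact add_le_add_right (U_mono L (Finset.sdiff_subset_sdiff subset_rfl hTB)) _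
    · have hlt : (B ∩ T).card < T.card :=
        Finset.card_lt_card (Finset.inter_subset_right.ssubset_of_ne
          fun h => hTB (Finset.inter_eq_right.1 h))
      have hcard : ((B ∩ T).card : ℝ) + 1 ≤ T.card := by exact_mod_cast hlt
      have hle : U (S \ B) L ≤ M := (U_mono L (Finset.subset_univ _)).trans hML
      have hmul := mul_le_mul_of_nonneg_left hcard hM
      have hnonneg := U_nonneg L (S \ T)
      linarith
  · have h := le_U_cons (Valn.const M hM T) L hT
    simpa [Valn.const] using h

/-- `A` is an allocation of items of `S` to the agents in `L` that maximizes the total value. -/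
def IsEfficient (S : Finset G) (L : List (Valn G)) (A : Fin L.length → Finset G) : Prop :=
  (∀ i j, i ≠ j → Disjoint (A i) (A j)) ∧ (∀ j, A j ⊆ S) ∧ ∑ j, (L.get j).v (A j) = U S L

theorem IsEfficient.cons {S B : Finset G} {w : Valn G} {L : List (Valn G)}
    {A : Fin L.length → Finset G} (hA : IsEfficient (S \ B) L A) (hB : B ⊆ S)
    (hU : w.v B + U (S \ B) L = U S (w :: L)) :
    IsEfficient S (w :: L) (Fin.cons B A : Fin (L.length + 1) → Finset G) := by
  obtain ⟨hdisj, hsub, hsum⟩ := hA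
  have hBA : ∀ j, Disjoint B (A j) := fun j =>
    Finset.disjoint_sdiff.mono_right (hsub j)
  refine ⟨?_, ?_, ?_⟩
  · intro i j hij
    induction i using Fin.cases with
    | zero =>
      induction j using Fin.cases with
      | zero => exact absurd rfl hij
      | succ j => exact hBA j
    | succ i =>
      induction j using Fin.cases with
      | zero => exact (hBA i).symm
      | succ j => exact hdisj i j fun h => hij (congrArg Fin.succ h)
  · intro j
    induction j using Fin.cases with
    | zero => exact hB
    | succ j => exact (hsub j).trans Finset.sdiff_subset
  · rw [← hU, ← hsum]
    exact Fin.sum_univ_succ _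

theorem exists_isEfficient (L : List (Valn G)) (S : Finset G) : ∃ A, IsEfficient S L A := by
  induction L generalizing S with
  | nil => exact ⟨fun _ => ∅, fun i => i.elim0, fun i => i.elim0, by simp [U_nil]⟩
  | cons w L ih =>
    obtain ⟨B, hB, hU⟩ := exists_U_cons w L S
    obtain ⟨A, hA⟩ := ih (S \ B)
    exact ⟨_, hA.cons hB hU⟩

theorem IsEfficient.const_cons {S T : Finset G} {L : List (Valn G)} {A : Fin L.length → Finset G}
    (hA : IsEfficient (S \ T) L A) {M : ℝ} (hM : 0 ≤ M) (hML : U Finset.univ L ≤ M) (hT : T ⊆ S) :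
    IsEfficient S (Valn.const M hM T :: L) (Fin.cons T A : Fin (L.length + 1) → Finset G) := by
  refine hA.cons hT ?_
  rw [U_const_cons L hM hML hT]
  simp [Valn.const]

/-- If the type space contains all additive valuations and the VCG mechanism is
false-name-proof with withdrawal on it, then the type space satisfies the
submodularity condition. -/
theorem vcg_fnpw_implies_submodular (Θ : Set (Valn G))
    (hadd : ∀ w : Valn G,
      (∃ c : G → ℝ, (∀ s, 0 ≤ c s) ∧ ∀ S : Finset G, w.v S = ∑ s ∈ S, c s) → w ∈ Θ)
    (hfnpw : VCGFNPW Θ) : SubmodularDomain Θ := by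
  intro Y hY S₁ S₂
  have hconst : ∀ (M : ℝ) (hM : 0 ≤ M) (T : Finset G), Valn.const M hM T ∈ Θ :=
    fun M hM T => hadd _ ⟨fun s => if s ∈ T then M else 0, fun s => by positivity,
      Valn.const_eq_sum M hM T⟩
  set D : Finset G := Finset.univ \ (S₁ ∪ S₂) with hD
  set X₁ : Finset G := S₁ \ S₂ with hX₁
  set X₂ : Finset G := S₂ \ S₁ with hX₂
  have hM := U_nonneg Y Finset.univ
  set d := Valn.const _ hM D with hd
  have hM₂ := U_nonneg (d :: Y) Finset.univ
  set k₂ := Valn.const _ hM₂ X₂ with hk₂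
  have hM₁ := U_nonneg (k₂ :: d :: Y) Finset.univ
  set k₁ := Valn.const _ hM₁ X₁ with hk₁
  have hle : U Finset.univ (d :: Y) ≤ U Finset.univ (k₂ :: d :: Y) := by
    have h := le_U_cons k₂ (d :: Y) (Finset.empty_subset Finset.univ)
    rwa [k₂.v_empty, zero_add, Finset.sdiff_empty] at h
  have hX₂X₁ : X₂ ⊆ Finset.univ \ X₁ := by grind
  have hDX₁ : D ⊆ Finset.univ \ X₁ := by grind
  have hDX₂ : D ⊆ Finset.univ \ X₂ := by grind
  have hDX₁₂ : D ⊆ (Finset.univ \ X₁) \ X₂ := by grind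
  have hsdiff : Finset.univ \ D = S₁ ∪ S₂ := by grind
  have hsdiff₁ : (Finset.univ \ X₁) \ D = S₂ := by grind
  have hsdiff₂ : (Finset.univ \ X₂) \ D = S₁ := by grind
  have hsdiff₁₂ : ((Finset.univ \ X₁) \ X₂) \ D = S₁ ∩ S₂ := by grind
  obtain ⟨A, hA⟩ := exists_isEfficient Y (((Finset.univ \ X₁) \ X₂) \ D)
  have hE := ((hA.const_cons hM le_rfl hDX₁₂).const_cons hM₂ le_rfl hX₂X₁).const_cons hM₁ le_rfl
    (Finset.subset_univ X₁)
  have key := hfnpw k₁ (hconst _ _ _) (d :: Y) [k₁] [k₂]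
    (by simpa using ⟨hconst _ _ _, hY⟩) (by simpa using hconst _ _ _)
    (by simpa using hconst _ _ _) _ hE.1 hE.2.2
  have hprice : k₁.v X₁ - (U Finset.univ (k₂ :: d :: Y) - U (Finset.univ \ X₁) (k₂ :: d :: Y))
      ≤ U Finset.univ (k₁ :: d :: Y) - U Finset.univ (d :: Y) := by
    simpa using key
  have hv : k₁.v X₁ = U Finset.univ (k₂ :: d :: Y) * (X₁.card : ℝ) := by
    simp [hk₁, Valn.const]
  have e₁ := U_const_cons (d :: Y) hM₁ hle (Finset.subset_univ X₁)
  have e₂ := U_const_cons (d :: Y) hM₂ le_rfl (Finset.subset_univ X₂)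
  have e₃ := U_const_cons (d :: Y) hM₂ le_rfl hX₂X₁
  have e₄ := U_const_cons Y hM le_rfl hDX₁
  have e₅ := U_const_cons Y hM le_rfl hDX₂
  have e₆ := U_const_cons Y hM le_rfl hDX₁₂
  have e₇ := U_const_cons Y hM le_rfl (Finset.subset_univ D)
  rw [hsdiff₁] at e₄
  rw [hsdiff₂] at e₅
  rw [hsdiff₁₂] at e₆
  rw [hsdiff] at e₇
  linarith
end
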